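/- arXiv:1405.3153 — 7 statements merged into one kernel-verified Lean document; each statement's English description precedes it below -/
import Mathlib

section
/- Let d ≥ 1, let S(q,p) = (q,-p) on ℝ^d × ℝ^d, let Ψ : ℝ^d × ℝ^d → ℝ^d × ℝ^d be a measurable map that preserves Lebesgue measure and is reversible (Ψ ∘ S ∘ Ψ = S), and let H : ℝ^d × ℝ^d → ℝ be measurable with H ∘ S = H. Define Δ = H ∘ Ψ - H and assume that Δ(x) exp(-H(x)) and Δ(x) exp(-H(Ψ(x))) are Lebesgue integrable over ℝ^{2d}. Then ∫_{ℝ^{2d}} Δ(x) exp(-H(x)) dx = - ∫_{ℝ^{2d}} Δ(x) exp(-H(Ψ(x))) dx. -/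
open MeasureTheory

/-- The momentum flip `S(q,p) = (q,-p)` on phase space `ℝᵈ × ℝᵈ`. -/
def momentumFlip (d : ℕ) : (Fin d → ℝ) × (Fin d → ℝ) → (Fin d → ℝ) × (Fin d → ℝ) :=
  fun x => (x.1, -x.2)

/-- For a volume-preserving reversible map `Ψ` and an energy `H` even in the momentum, with
`Δ = H ∘ Ψ - H`, one has `∫ Δ e^{-H} = -∫ Δ e^{-H∘Ψ}` over phase space. -/
theorem average_energy_error_flip (d : ℕ) (hd : 1 ≤ d)
    (Ψ : (Fin d → ℝ) × (Fin d → ℝ) → (Fin d → ℝ) × (Fin d → ℝ))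
    (hΨmeas : MeasurePreserving Ψ volume volume)
    (hΨrev : Ψ ∘ momentumFlip d ∘ Ψ = momentumFlip d)
    (H : (Fin d → ℝ) × (Fin d → ℝ) → ℝ) (hHmeas : Measurable H)
    (hH : H ∘ momentumFlip d = H)
    (hint1 : Integrable (fun x => (H (Ψ x) - H x) * Real.exp (-H x)) volume)
    (hint2 : Integrable (fun x => (H (Ψ x) - H x) * Real.exp (-H (Ψ x))) volume) :
    ∫ x, (H (Ψ x) - H x) * Real.exp (-H x)
      = -∫ x, (H (Ψ x) - H x) * Real.exp (-H (Ψ x)) := by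
  have hS : MeasurePreserving (momentumFlip d) volume volume :=
    (MeasurePreserving.id (volume : Measure (Fin d → ℝ))).prod
      (Measure.measurePreserving_neg (volume : Measure (Fin d → ℝ)))
  have hT : MeasurePreserving (momentumFlip d ∘ Ψ) volume volume := hS.comp hΨmeas
  have hHS : ∀ x, H (momentumFlip d x) = H x := fun x => congrFun hH x
  have hrev : ∀ x, Ψ (momentumFlip d (Ψ x)) = momentumFlip d x := fun x => congrFun hΨrev x
  have key := integral_map (μ := volume) hT.measurable.aemeasurable
    (f := fun x => (H (Ψ x) - H x) * Real.exp (-H x))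
    (by rw [hT.map_eq]; exact hint1.aestronglyMeasurable)
  rw [hT.map_eq] at key
  rw [key, ← integral_neg]
  refine integral_congr_ae (Filter.Eventually.of_forall fun x => ?_)
  simp only [Function.comp_apply, hrev, hHS]
  ring
end

section
/- Let d ≥ 1, let S(q,p) = (q,-p) on ℝ^d × ℝ^d, let Ψ : ℝ^d × ℝ^d → ℝ^d × ℝ^d be a measurable map that preserves Lebesgue measure and is reversible (Ψ ∘ S ∘ Ψ = S), and let H : ℝ^d × ℝ^d → ℝ be measurable with H ∘ S = H. Define Δ = H ∘ Ψ - H and assume that Δ(x) exp(-H(x)) and Δ(x) exp(-H(Ψ(x))) are Lebesgue integrable over ℝ^{2d}. Then ∫_{ℝ^{2d}} Δ(x) exp(-H(x)) dx = (1/2) ∫_{ℝ^{2d}} Δ(x) [1 - exp(-Δ(x))] exp(-H(x)) dx. -/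
open MeasureTheory

/-- For a volume-preserving reversible map `Ψ` and an energy `H` even in the momentum, with
`Δ = H ∘ Ψ - H`, one has `∫ Δ e^{-H} = (1/2) ∫ Δ (1 - e^{-Δ}) e^{-H}` over phase space. -/
theorem average_energy_error_identity (d : ℕ) (hd : 1 ≤ d)
    (Ψ : (Fin d → ℝ) × (Fin d → ℝ) → (Fin d → ℝ) × (Fin d → ℝ))
    (hΨmeas : MeasurePreserving Ψ volume volume)
    (hΨrev : Ψ ∘ momentumFlip d ∘ Ψ = momentumFlip d)
    (H : (Fin d → ℝ) × (Fin d → ℝ) → ℝ) (hHmeas : Measurable H)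
    (hH : H ∘ momentumFlip d = H)
    (hint1 : Integrable (fun x => (H (Ψ x) - H x) * Real.exp (-H x)) volume)
    (hint2 : Integrable (fun x => (H (Ψ x) - H x) * Real.exp (-H (Ψ x))) volume) :
    ∫ x, (H (Ψ x) - H x) * Real.exp (-H x)
      = (1 / 2) * ∫ x, (H (Ψ x) - H x) * (1 - Real.exp (-(H (Ψ x) - H x))) * Real.exp (-H x) := by
  have hS : MeasurePreserving (momentumFlip d) volume volume :=
    (MeasurePreserving.id (volume : Measure (Fin d → ℝ))).prod
      (Measure.measurePreserving_neg (volume : Measure (Fin d → ℝ)))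
  have hT := hS.comp hΨmeas
  have hHS : ∀ x, H (momentumFlip d x) = H x := fun x => congrFun hH x
  have hR : ∀ x, Ψ (momentumFlip d (Ψ x)) = momentumFlip d x := fun x => congrFun hΨrev x
  have key : ∫ x, (H (Ψ x) - H x) * Real.exp (-H x)
      = - ∫ x, (H (Ψ x) - H x) * Real.exp (-H (Ψ x)) := by
    have h1 := hint1.aestronglyMeasurable
    rw [← hT.map_eq] at h1
    have h2 := integral_map hT.measurable.aemeasurable h1
    rw [hT.map_eq] at h2
    rw [h2, ← integral_neg]
    congr 1
    funext x
    simp only [Function.comp_apply, hR, hHS]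
    ring
  have h3 : ∫ x, (H (Ψ x) - H x) * (1 - Real.exp (-(H (Ψ x) - H x))) * Real.exp (-H x)
      = (∫ x, (H (Ψ x) - H x) * Real.exp (-H x))
        - ∫ x, (H (Ψ x) - H x) * Real.exp (-H (Ψ x)) := by
    rw [← integral_sub hint1 hint2]
    congr 1
    funext x
    have : Real.exp (-H (Ψ x)) = Real.exp (-(H (Ψ x) - H x)) * Real.exp (-H x) := by
      rw [← Real.exp_add]
      congr 1
      ring
    rw [this]
    ring
  rw [h3]
  linarith
end

section
/- Let d ≥ 1, let S(q,p) = (q,-p) on ℝ^d × ℝ^d, let Ψ : ℝ^d × ℝ^d → ℝ^d × ℝ^d be a measurable map that preserves Lebesgue measure and is reversible (Ψ ∘ S ∘ Ψ = S), and let H : ℝ^d × ℝ^d → ℝ be measurable with H ∘ S = H. Define Δ = H ∘ Ψ - H and assume that Δ(x) exp(-H(x)), Δ(x) exp(-H(Ψ(x))), and Δ(x)² exp(-H(x)) are Lebesgue integrable over ℝ^{2d}. Then 0 ≤ ∫_{ℝ^{2d}} Δ(x) exp(-H(x)) dx ≤ ∫_{ℝ^{2d}} Δ(x)² exp(-H(x))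 dx. In other words, the average energy error with respect to the Boltzmann measure is nonnegative and is bounded by the average of the squared energy error. -/
open MeasureTheory

lemma exp_neg_diff_le (a b : ℝ) :
    Real.exp (-a) - Real.exp (-b) ≤ (b - a) * Real.exp (-a) := by
  have h1 := Real.add_one_le_exp (a - b)
  have h2 : Real.exp (-b) = Real.exp (a - b) * Real.exp (-a) := by
    rw [← Real.exp_add]; congr 1; ring
  have h3 := mul_le_mul_of_nonneg_right h1 (Real.exp_pos (-a)).le
  rw [h2]; linarith

lemma pointwise_lower (a b : ℝ) :
    0 ≤ (b - a) * Real.exp (-a) - (b - a) * Real.exp (-b) := by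
  rw [← mul_sub]
  rcases le_total a b with h | h
  · exact mul_nonneg (sub_nonneg.2 h) (sub_nonneg.2 (Real.exp_le_exp.2 (by linarith)))
  · exact mul_nonneg_of_nonpos_of_nonpos (sub_nonpos.2 h)
      (sub_nonpos.2 (Real.exp_le_exp.2 (by linarith)))

lemma pointwise_upper (a b : ℝ) :
    (b - a) * Real.exp (-a) - (b - a) * Real.exp (-b) ≤
      (b - a) ^ 2 * Real.exp (-a) + (b - a) ^ 2 * Real.exp (-b) := by
  have p1 := mul_nonneg (sq_nonneg (b - a)) (Real.exp_pos (-a)).le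
  have p2 := mul_nonneg (sq_nonneg (b - a)) (Real.exp_pos (-b)).le
  rcases le_total a b with h | h
  · have := mul_le_mul_of_nonneg_left (exp_neg_diff_le a b) (sub_nonneg.2 h)
    nlinarith
  · have := mul_le_mul_of_nonneg_left (exp_neg_diff_le b a) (sub_nonneg.2 h)
    nlinarith

lemma momentumFlip_measurePreserving (d : ℕ) :
    MeasurePreserving (momentumFlip d) volume volume :=
  (MeasurePreserving.id (volume : Measure (Fin d → ℝ))).prod
    (Measure.measurePreserving_neg (volume : Measure (Fin d → ℝ)))

/-- For a volume-preserving reversible map `Ψ` and an energy `H` even in the momentum, with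
`Δ = H ∘ Ψ - H`, the average energy error with respect to the Boltzmann measure is
nonnegative and bounded by the average of the squared energy error:
`0 ≤ ∫ Δ e^{-H} ≤ ∫ Δ² e^{-H}`. -/
theorem average_energy_error_bounds (d : ℕ) (hd : 1 ≤ d)
    (Ψ : (Fin d → ℝ) × (Fin d → ℝ) → (Fin d → ℝ) × (Fin d → ℝ))
    (hΨmeas : MeasurePreserving Ψ volume volume)
    (hΨrev : Ψ ∘ momentumFlip d ∘ Ψ = momentumFlip d)
    (H : (Fin d → ℝ) × (Fin d → ℝ) → ℝ) (hHmeas : Measurable H)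
    (hH : H ∘ momentumFlip d = H)
    (hint1 : Integrable (fun x => (H (Ψ x) - H x) * Real.exp (-H x)) volume)
    (hint2 : Integrable (fun x => (H (Ψ x) - H x) * Real.exp (-H (Ψ x))) volume)
    (hint3 : Integrable (fun x => (H (Ψ x) - H x) ^ 2 * Real.exp (-H x)) volume) :
    0 ≤ ∫ x, (H (Ψ x) - H x) * Real.exp (-H x) ∧
      ∫ x, (H (Ψ x) - H x) * Real.exp (-H x)
        ≤ ∫ x, (H (Ψ x) - H x) ^ 2 * Real.exp (-H x) := by
  have hSS : ∀ x, momentumFlip d (momentumFlip d x) = x := fun x => by simp [momentumFlip]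
  have hHS : ∀ x, H (momentumFlip d x) = H x := fun x => congrFun hH x
  have hrev : ∀ x, Ψ (momentumFlip d (Ψ x)) = momentumFlip d x := fun x => congrFun hΨrev x
  have hT := (momentumFlip_measurePreserving d).comp hΨmeas
  have hTT : Function.Involutive (momentumFlip d ∘ Ψ) := fun x => by
    simp only [Function.comp_apply, hrev, hSS]
  let e : ((Fin d → ℝ) × (Fin d → ℝ)) ≃ᵐ ((Fin d → ℝ) × (Fin d → ℝ)) :=
    { toEquiv := hTT.toPerm
      measurable_toFun := hT.measurable
      measurable_invFun := hT.measurable }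
  have hemb : MeasurableEmbedding (momentumFlip d ∘ Ψ) := e.measurableEmbedding
  have e1 := hT.integral_comp hemb (fun x => (H (Ψ x) - H x) * Real.exp (-H x))
  have e2 := hT.integral_comp hemb (fun x => (H (Ψ x) - H x) ^ 2 * Real.exp (-H x))
  have i2 := (hT.integrable_comp_emb hemb).2 hint3
  have hsq : ∀ x, (H x - H (Ψ x)) ^ 2 = (H (Ψ x) - H x) ^ 2 := fun x => by ring
  have hneg : ∀ x, (H x - H (Ψ x)) * Real.exp (-H (Ψ x))
      = -((H (Ψ x) - H x) * Real.exp (-H (Ψ x))) := fun x => by ring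
  simp only [Function.comp_apply, Function.comp_def, hrev, hHS, hsq, hneg, integral_neg]
    at e1 e2 i2
  have k1 := integral_sub hint1 hint2
  have k2 := integral_add hint3 i2
  have l1 : 0 ≤ ∫ x, ((H (Ψ x) - H x) * Real.exp (-H x)
      - (H (Ψ x) - H x) * Real.exp (-H (Ψ x))) :=
    integral_nonneg fun x => pointwise_lower _ _
  have l2 := integral_mono (hint1.sub hint2) (hint3.add i2)
    (fun x => pointwise_upper (H x) (H (Ψ x)))
  simp only [Pi.sub_apply, Pi.add_apply] at l2
  constructor <;> linarith
end

section
/- Let χ ∈ ℝ with χ² ≥ 1 (and χ ≠ 0), let c, s ∈ ℝ with c² + s² = 1, and let q₀, p₀ ∈ ℝ. Define q₁ = c·q₀ + χ·s·p₀ and p₁ = -χ⁻¹·s·q₀ + c·p₀, and let Δ = (1/2)(q₁² + p₁²) - (1/2)(q₀² + p₀²) be the energy error for the standard harmonic oscillator Hamiltonian H = (1/2)(p² + q²). Then Δ ≤ (1/2)(χ² - 1)·p₀². -/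
/-- Proposition 2 (first case): energy-error bound for the standard harmonic oscillator
when `χ² ≥ 1`. -/
theorem energy_error_bound_of_one_le_chi_sq (χ : ℝ) (hχ : χ ≠ 0) (hχ1 : 1 ≤ χ ^ 2)
    (c s : ℝ) (hcs : c ^ 2 + s ^ 2 = 1) (q₀ p₀ : ℝ) :
    (1 / 2) * ((c * q₀ + χ * s * p₀) ^ 2 + (-χ⁻¹ * s * q₀ + c * p₀) ^ 2)
      - (1 / 2) * (q₀ ^ 2 + p₀ ^ 2) ≤ (1 / 2) * (χ ^ 2 - 1) * p₀ ^ 2 := by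
  have h1 : χ * (-χ⁻¹ * s * q₀ + c * p₀) = -s * q₀ + χ * c * p₀ := by
    field_simp
  generalize -χ⁻¹ * s * q₀ + c * p₀ = P at h1 ⊢
  -- the modified energy `q² + χ² p²` is conserved
  have h2 : (c * q₀ + χ * s * p₀) ^ 2 + χ ^ 2 * P ^ 2 = q₀ ^ 2 + χ ^ 2 * p₀ ^ 2 := by
    rw [← mul_pow, h1]
    linear_combination (q₀ ^ 2 + χ ^ 2 * p₀ ^ 2) * hcs
  have h3 : 0 ≤ (χ ^ 2 - 1) * P ^ 2 := mul_nonneg (by linarith) (sq_nonneg P)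
  linarith
end

section
/- Let χ ∈ ℝ with 0 < χ² ≤ 1, let c, s ∈ ℝ with c² + s² = 1, and let q₀, p₀ ∈ ℝ. Define q₁ = c·q₀ + χ·s·p₀ and p₁ = -χ⁻¹·s·q₀ + c·p₀, and let Δ = (1/2)(q₁² + p₁²) - (1/2)(q₀² + p₀²) be the energy error for the standard harmonic oscillator Hamiltonian H = (1/2)(p² + q²). Then Δ ≤ (1/2)(χ⁻² - 1)·q₀². -/
/-- Proposition 2 (second case): energy-error bound for the standard harmonic oscillator
when `0 < χ² ≤ 1`. -/
theorem energy_error_bound_of_chi_sq_le_one (χ : ℝ) (hχpos : 0 < χ ^ 2) (hχ1 : χ ^ 2 ≤ 1)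
    (c s : ℝ) (hcs : c ^ 2 + s ^ 2 = 1) (q₀ p₀ : ℝ) :
    (1 / 2) * ((c * q₀ + χ * s * p₀) ^ 2 + (-χ⁻¹ * s * q₀ + c * p₀) ^ 2)
      - (1 / 2) * (q₀ ^ 2 + p₀ ^ 2) ≤ (1 / 2) * ((χ ^ 2)⁻¹ - 1) * q₀ ^ 2 := by
  have hχ : χ ≠ 0 := by
    rintro rfl
    simp at hχpos
  obtain ⟨y, rfl⟩ : ∃ y, q₀ = χ * y := ⟨χ⁻¹ * q₀, by field_simp⟩
  have h1 : -χ⁻¹ * s * (χ * y) = -(s * y) := by field_simp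
  have h2 : (1 / 2) * ((χ ^ 2)⁻¹ - 1) * (χ * y) ^ 2 = (1 / 2) * (y ^ 2 - χ ^ 2 * y ^ 2) := by
    field_simp
  have h3 : 0 ≤ (1 - χ ^ 2) * (c * y + s * p₀) ^ 2 :=
    mul_nonneg (by linarith) (sq_nonneg _)
  have h4 : (c * y + s * p₀) ^ 2 + (-(s * y) + c * p₀) ^ 2 = y ^ 2 + p₀ ^ 2 := by
    linear_combination (y ^ 2 + p₀ ^ 2) * hcs
  rw [h1, h2]
  linarith
end

section
/- Let χ ≠ 0 and α ∈ ℝ, and let μ be the standard Gaussian measure on ℝ² (i.e., (q₀, p₀) are independent standard normal random variables). Define q₁ = cos(α)·q₀ + χ·sin(α)·p₀ and p₁ = -χ⁻¹·sin(α)·q₀ + cos(α)·p₀, and Δ(q₀,p₀) = (1/2)(q₁² + p₁²) - (1/2)(q₀² + p₀²). Then the expectation of Δ satisfies 𝔼(Δ) = ∫_{ℝ²} Δ dμ = sin²(α) · ρ, where ρ = (1/2)(χ - χ⁻¹)² = (1/2)(χ² + χ⁻² - 2) ≥ 0. Consequently 0 ≤ 𝔼(Δ) ≤ ρ. -/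
open MeasureTheory ProbabilityTheory Real

/-- Proposition 3: for a standard Gaussian initial condition on `ℝ²`, the expected energy
error of the map `(q₀,p₀) ↦ (cos α·q₀ + χ sin α·p₀, -χ⁻¹ sin α·q₀ + cos α·p₀)` for the
standard harmonic oscillator equals `sin²(α)·ρ` with `ρ = (1/2)(χ - χ⁻¹)²
= (1/2)(χ² + χ⁻² - 2) ≥ 0`; consequently `0 ≤ 𝔼(Δ) ≤ ρ`. -/
theorem expected_energy_error_gaussian (χ : ℝ) (hχ : χ ≠ 0) (α : ℝ)
    (μ : Measure (ℝ × ℝ)) (hμ : μ = (gaussianReal 0 1).prod (gaussianReal 0 1))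
    (Δ : ℝ × ℝ → ℝ)
    (hΔ : ∀ x : ℝ × ℝ,
      Δ x = (1 / 2) * ((cos α * x.1 + χ * sin α * x.2) ^ 2
          + (-χ⁻¹ * sin α * x.1 + cos α * x.2) ^ 2)
        - (1 / 2) * (x.1 ^ 2 + x.2 ^ 2)) :
    (1 / 2) * (χ - χ⁻¹) ^ 2 = (1 / 2) * (χ ^ 2 + (χ ^ 2)⁻¹ - 2) ∧
    0 ≤ (1 / 2) * (χ - χ⁻¹) ^ 2 ∧
    (∫ x, Δ x ∂μ) = sin α ^ 2 * ((1 / 2) * (χ - χ⁻¹) ^ 2) ∧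
    0 ≤ ∫ x, Δ x ∂μ ∧ (∫ x, Δ x ∂μ) ≤ (1 / 2) * (χ - χ⁻¹) ^ 2 := by
  have hρ : 0 ≤ (1 / 2) * (χ - χ⁻¹) ^ 2 := by positivity
  have hm : MemLp (fun x : ℝ => x) 2 (gaussianReal 0 1) :=
    memLp_id_gaussianReal' 2 (by simp)
  have hi1 : Integrable (fun x : ℝ => x) (gaussianReal 0 1) := hm.integrable (by norm_num)
  have hi2 : Integrable (fun x : ℝ => x ^ 2) (gaussianReal 0 1) := hm.integrable_sq
  have h1 : ∫ x, x ∂(gaussianReal 0 1) = 0 := integral_id_gaussianReal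
  have h2 : ∫ x, x ^ 2 ∂(gaussianReal 0 1) = 1 := by
    have hv : Var[fun x ↦ x; gaussianReal 0 1] = ((1 : NNReal) : ℝ) :=
      variance_fun_id_gaussianReal
    rw [variance_of_integral_eq_zero hm.aemeasurable h1] at hv
    simpa using hv
  have key : (∫ x, Δ x ∂μ) = sin α ^ 2 * ((1 / 2) * (χ - χ⁻¹) ^ 2) := by
    subst hμ
    have hf : ∀ x : ℝ × ℝ, Δ x =
        ((cos α ^ 2 + χ⁻¹ ^ 2 * sin α ^ 2 - 1) / 2) * x.1 ^ 2
        + ((cos α ^ 2 + χ ^ 2 * sin α ^ 2 - 1) / 2) * x.2 ^ 2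
        + (cos α * sin α * (χ - χ⁻¹)) * (x.1 * x.2) := by
      intro x
      rw [hΔ x]
      ring
    have j1 : Integrable (fun x : ℝ × ℝ => x.1 ^ 2)
        ((gaussianReal 0 1).prod (gaussianReal 0 1)) := hi2.comp_fst _
    have j2 : Integrable (fun x : ℝ × ℝ => x.2 ^ 2)
        ((gaussianReal 0 1).prod (gaussianReal 0 1)) := hi2.comp_snd _
    have j3 : Integrable (fun x : ℝ × ℝ => x.1 * x.2)
        ((gaussianReal 0 1).prod (gaussianReal 0 1)) := hi1.mul_prod hi1
    have k1 : ∫ x : ℝ × ℝ, x.1 ^ 2 ∂((gaussianReal 0 1).prod (gaussianReal 0 1)) = 1 := by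
      rw [integral_fun_fst (fun x : ℝ => x ^ 2), h2]
      simp
    have k2 : ∫ x : ℝ × ℝ, x.2 ^ 2 ∂((gaussianReal 0 1).prod (gaussianReal 0 1)) = 1 := by
      rw [integral_fun_snd (fun x : ℝ => x ^ 2), h2]
      simp
    have k3 : ∫ x : ℝ × ℝ, x.1 * x.2 ∂((gaussianReal 0 1).prod (gaussianReal 0 1)) = 0 := by
      rw [integral_prod_mul (fun x : ℝ => x) (fun x : ℝ => x), h1]
      simp
    simp_rw [hf]
    rw [integral_add (by exact (j1.const_mul _).add (j2.const_mul _)) (j3.const_mul _),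
      integral_add (j1.const_mul _) (j2.const_mul _), integral_const_mul, integral_const_mul,
      integral_const_mul, k1, k2, k3, cos_sq']
    field_simp
    ring
  refine ⟨?_, hρ, key, ?_, ?_⟩
  · field_simp
    ring
  · rw [key]
    positivity
  · rw [key]
    exact mul_le_of_le_one_left hρ (sin_sq_le_one α)
end

section
/- Let r be a positive integer and let P be a real polynomial of degree at most r with P(0) = 1 and P'(0) = -1/2. If ζ_max > 0 is such that -1 ≤ P(ζ) ≤ 1 for all ζ ∈ [0, ζ_max], then ζ_max ≤ 4r². -/
/-- Optimal stability of Verlet: a real polynomial of degree at most `r` with `P(0) = 1` and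
`P'(0) = -1/2` cannot satisfy `-1 ≤ P(ζ) ≤ 1` on `[0, ζmax]` when `ζmax > 4r²`. -/
theorem stability_interval_bound (r : ℕ) (hr : 1 ≤ r) (P : Polynomial ℝ)
    (hdeg : P.natDegree ≤ r) (h0 : P.eval 0 = 1)
    (h0' : (Polynomial.derivative P).eval 0 = -(1 / 2))
    (ζmax : ℝ) (hζ : 0 < ζmax)
    (hstab : ∀ ζ ∈ Set.Icc (0 : ℝ) ζmax, -1 ≤ P.eval ζ ∧ P.eval ζ ≤ 1) :
    ζmax ≤ 4 * r ^ 2 := by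
  set L : Polynomial ℝ := Polynomial.C (ζmax / 2) - Polynomial.C (ζmax / 2) * Polynomial.X with hL
  have hLdeg : L.natDegree ≤ 1 := by
    rw [hL]
    compute_degree
  have hdegQ : (P.comp L).degree ≤ (r : ℕ) := by
    apply Polynomial.degree_le_of_natDegree_le
    refine Polynomial.natDegree_comp_le.trans ?_
    calc P.natDegree * L.natDegree ≤ r * 1 := Nat.mul_le_mul hdeg hLdeg
      _ = r := mul_one r
  have hbnd : ∀ x ∈ Set.Icc (-1 : ℝ) 1, |(P.comp L).eval x| ≤ 1 := by
    intro x hx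
    have hev : L.eval x = ζmax / 2 * (1 - x) := by
      simp [hL]
      ring
    rw [Polynomial.eval_comp, hev]
    refine abs_le.mpr (hstab _ ⟨?_, ?_⟩)
    · have := hx.2
      exact mul_nonneg (by positivity) (by linarith)
    · have := hx.1
      nlinarith
  have key := Polynomial.Chebyshev.eval_iterate_derivative_le_of_forall_abs_le_one (k := 1)
    (le_refl (1 : ℝ)) hdegQ hbnd
  have hT : (Polynomial.derivative (Polynomial.Chebyshev.T ℝ (r : ℤ))).eval 1 = (r : ℝ) ^ 2 := by
    simp [Polynomial.Chebyshev.T_derivative_eq_U]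
    try ring
  simp only [Function.iterate_one] at key
  rw [hT, Polynomial.derivative_comp] at key
  simp [hL, h0'] at key
  linarith
end
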